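/- Let k be an algebraically closed field and let i, r, m, n be integers with 1 ≤ i ≤ r ≤ n ≤ m. For an integer s with 0 ≤ s ≤ r − i + 1, let X_s be the set of pairs (α, β) ∈ Hom_k(k^m, k^r) × Hom_k(k^r, k^n) with rank(α) ≤ s + i − 1, rank(β) ≤ r − s, and rank(βα) ≤ i − 1. Then X_s is an irreducible Zariski-closed subset of the affine space Hom_k(k^m, k^r) × Hom_k(k^r, k^n), of dimension (s + i − 1)(r + m − s − i + 1) + (r − s)·n + (i − 1)·s; equivalently, in the polynomial ring over k in the entries of generic matrices α (r × m) and β (n × r), the radical of the ideal I_{s+i}(α) + I_{r−s+1}(β) + I_i(βα) is prime and the Krull dimension of the quotient by it equals (s + i − 1)(r + m − s − i + 1) + (r − s)·n + (i − 1)·s. -/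

import Mathlib

open IsLocalRing

noncomputable section

/-- The ideal of `i × i` minors of a matrix. -/
def Matrix.minorsIdeal {R : Type*} [CommRing R] {n m : ℕ}
    (φ : Matrix (Fin n) (Fin m) R) (i : ℕ) : Ideal R :=
  Ideal.span { d | ∃ (f : Fin i → Fin n) (g : Fin i → Fin m), d = (φ.submatrix f g).det }

/-- The height of an ideal: the minimal height of a prime ideal containing it
(`⊤`, i.e. `+∞`, if there is no such prime). -/
def Ideal.ht {R : Type*} [CommRing R] (I : Ideal R) : ℕ∞ :=
  ⨅ (P : PrimeSpectrum R) (_ : I ≤ P.asIdeal), Order.height P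

/-- The minimal number of generators of a module. -/
def Module.mu (R M : Type*) [Semiring R] [AddCommMonoid M] [Module R M] : ℕ :=
  sInf {n | ∃ v : Fin n → M, Submodule.span R (Set.range v) = ⊤}

/-- A local ring is regular if it is Noetherian and its maximal ideal can be generated by
`dim R` elements. -/
def IsRegularLocal (R : Type*) [CommRing R] [IsLocalRing R] : Prop :=
  IsNoetherianRing R ∧
    (Module.mu R (maximalIdeal R) : ℕ∞) = Order.height (closedPoint R)

/-- The generic `r × m` matrix `α`, over the polynomial ring in the entries of a generic
`r × m` matrix and a generic `n × r` matrix. -/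
def genericAlpha (k : Type*) [Field k] (r m n : ℕ) :
    Matrix (Fin r) (Fin m) (MvPolynomial ((Fin r × Fin m) ⊕ (Fin n × Fin r)) k) :=
  Matrix.of fun a b => MvPolynomial.X (Sum.inl (a, b))

/-- The generic `n × r` matrix `β`, over the polynomial ring in the entries of a generic
`r × m` matrix and a generic `n × r` matrix. -/
def genericBeta (k : Type*) [Field k] (r m n : ℕ) :
    Matrix (Fin n) (Fin r) (MvPolynomial ((Fin r × Fin m) ⊕ (Fin n × Fin r)) k) :=
  Matrix.of fun a b => MvPolynomial.X (Sum.inr (a, b))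

/-- An injective integral extension preserves Krull dimension. -/
theorem ringKrullDim_eq_of_isIntegral (R S : Type*) [CommRing R] [CommRing S] [Algebra R S]
    [Algebra.IsIntegral R S] (hinj : Function.Injective (algebraMap R S)) :
    ringKrullDim S = ringKrullDim R := by
  apply le_antisymm
  · exact Order.krullDim_le_of_strictMono (PrimeSpectrum.comap (algebraMap R S))
      fun I J hIJ => Ideal.IsIntegral.comap_lt_comap (R := R) hIJ
  · refine iSup_le fun l => ?_
    obtain ⟨Q, -, hQ, hQc⟩ := Ideal.exists_ideal_over_prime_of_isIntegral
      (S := S) (RelSeries.head l).asIdeal ⊥ (by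
        rw [← RingHom.ker_eq_comap_bot, (RingHom.injective_iff_ker_eq_bot _).1 hinj]
        exact bot_le)
    have : Q.LiesOver (RelSeries.head l).asIdeal := ⟨hQc.symm⟩
    obtain ⟨L, hL, -⟩ := Ideal.exists_ltSeries_of_hasGoingUp l Q
    rw [← hL]
    exact le_iSup (fun p : LTSeries (PrimeSpectrum S) => (p.length : WithBot ℕ∞)) L

/-- The Krull dimension of a finitely generated domain over a field is the cardinality of any
transcendence basis. -/
theorem ringKrullDim_eq_card_of_isTranscendenceBasis {k A ι : Type*} [Field k] [CommRing A]
    [IsDomain A] [Algebra k A] [Algebra.FiniteType k A] [Fintype ι] {x : ι → A}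
    (hx : IsTranscendenceBasis k x) : ringKrullDim A = Fintype.card ι := by
  obtain ⟨t, g, hg, hint⟩ := exists_integral_inj_algHom_of_fg k A
  algebraize [g.toRingHom]
  have hinj : Function.Injective (algebraMap (MvPolynomial (Fin t) k) A) := hg
  have : FaithfulSMul (MvPolynomial (Fin t) k) A :=
    (faithfulSMul_iff_algebraMap_injective _ _).2 hinj
  have hy : IsTranscendenceBasis k _ :=
    (IsTranscendenceBasis.mvPolynomial (Fin t) k).algebraMap_comp (A := A)
  have hcard : Fintype.card ι = t := by
    have := hx.lift_cardinalMk_eq hy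
    simpa using this
  rw [ringKrullDim_eq_of_isIntegral (MvPolynomial (Fin t) k) A hinj,
    MvPolynomial.ringKrullDim_of_isNoetherianRing, ringKrullDim_eq_zero_of_field]
  simp [hcard]

theorem Matrix.exists_linearIndependent_col_submatrix {L m n : Type*} [Field L] [Finite m]
    [Fintype n] (M : Matrix m n L) {j : ℕ} (hj : j ≤ M.rank) :
    ∃ g : Fin j → n, LinearIndependent L (M.submatrix id g).col := by
  rw [Matrix.rank_eq_finrank_span_cols] at hj
  obtain ⟨f, hf, -, hind⟩ := Submodule.exists_fun_fin_finrank_span_eq L (Set.range M.col)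
  choose g hg using hf
  refine ⟨g ∘ Fin.castLE hj, ?_⟩
  have h := hind.comp _ (Fin.castLE_injective hj)
  convert! h using 1
  funext i
  exact hg _

open scoped Matrix in
/-- A matrix over a field has rank less than `j` iff all its `j × j` minors vanish. -/
theorem Matrix.rank_lt_iff_forall_det_submatrix_eq_zero {L m n : Type*} [Field L] [Fintype m]
    [Fintype n] (M : Matrix m n L) (j : ℕ) :
    M.rank < j ↔ ∀ (f : Fin j → m) (g : Fin j → n), (M.submatrix f g).det = 0 := by
  constructor
  · intro h f g
    by_contra hdet
    have h1 := Matrix.rank_of_det_ne_zero hdet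
    have h2 := Matrix.rank_submatrix_le M f g
    simp only [Fintype.card_fin] at h1
    omega
  · contrapose!
    intro h
    obtain ⟨g, hg⟩ := M.exists_linearIndependent_col_submatrix h
    have hr : (M.submatrix id g)ᵀ.rank = j := by
      simpa using LinearIndependent.rank_matrix (M := (M.submatrix id g)ᵀ) hg
    rw [Matrix.rank_transpose] at hr
    obtain ⟨f, hf⟩ := (M.submatrix id g)ᵀ.exists_linearIndependent_col_submatrix
      (j := j) (by rw [Matrix.rank_transpose, hr])
    refine ⟨f, g, ?_⟩
    have : LinearIndependent L (M.submatrix f g).row := hf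
    rw [Matrix.linearIndependent_rows_iff_isUnit, Matrix.isUnit_iff_isUnit_det] at this
    exact this.ne_zero

/-- A ring homomorphism to a field kills the `j × j` minors of a matrix iff the image of the matrix
has rank less than `j`. -/
theorem Matrix.minorsIdeal_le_ker_iff {R L : Type*} [CommRing R] [Field L] (f : R →+* L)
    {n m : ℕ} (M : Matrix (Fin n) (Fin m) R) (j : ℕ) :
    M.minorsIdeal j ≤ RingHom.ker f ↔ (M.map f).rank < j := by
  rw [Matrix.rank_lt_iff_forall_det_submatrix_eq_zero, Matrix.minorsIdeal, Ideal.span_le]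
  constructor
  · intro h p q
    have := h ⟨p, q, rfl⟩
    simpa [RingHom.mem_ker, RingHom.map_det, RingHom.mapMatrix_apply, Matrix.submatrix_map]
      using this
  · rintro h _ ⟨p, q, rfl⟩
    simpa [RingHom.mem_ker, RingHom.map_det, RingHom.mapMatrix_apply, Matrix.submatrix_map]
      using h p q

/-- Between two nested subspaces there is a subspace of every intermediate dimension. -/
theorem Submodule.exists_finrank_eq_of_le {L E : Type*} [Field L] [AddCommGroup E] [Module L E]
    [FiniteDimensional L E] {W V : Submodule L E} (hWV : W ≤ V) {d : ℕ}
    (h1 : Module.finrank L W ≤ d) (h2 : d ≤ Module.finrank L V) :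
    ∃ K : Submodule L E, W ≤ K ∧ K ≤ V ∧ Module.finrank L K = d := by
  induction d, h1 using Nat.le_induction with
  | base => exact ⟨W, le_rfl, hWV, rfl⟩
  | succ d _ ih =>
    obtain ⟨K, hWK, hKV, hK⟩ := ih (by omega)
    obtain ⟨v, hv, hvK⟩ : ∃ v ∈ V, v ∉ K := by
      by_contra! h
      have := Submodule.finrank_mono (show V ≤ K from h)
      omega
    refine ⟨K ⊔ Submodule.span L {v}, hWK.trans le_sup_left,
      sup_le hKV (by simpa using hv), ?_⟩
    have hv0 : v ≠ 0 := fun h => hvK (h ▸ K.zero_mem)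
    have hdisj : K ⊓ Submodule.span L {v} = ⊥ :=
      ((Submodule.disjoint_span_singleton' hv0).2 hvK).eq_bot
    have := Submodule.finrank_sup_add_finrank_inf_eq K (Submodule.span L {v})
    rw [hdisj, finrank_bot, finrank_span_singleton hv0, hK] at this
    exact this

/-- Given subspaces `U` and `V` such that `U` has dimension at most `c + s`, `V` has dimension at
least `s` and `U` has dimension at most `c` modulo `V`, there is a flag `K ≤ A` of dimensions `s`
and `c + s` with `U ≤ A` and `K ≤ V`. -/
theorem Submodule.exists_flag {L E : Type*} [Field L] [AddCommGroup E] [Module L E]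
    [FiniteDimensional L E] (U V : Submodule L E) {c s : ℕ}
    (hU : Module.finrank L U ≤ c + s) (hV : s ≤ Module.finrank L V)
    (hUV : Module.finrank L U ≤ c + Module.finrank L (U ⊓ V : Submodule L E))
    (hE : c + s ≤ Module.finrank L E) :
    ∃ K A : Submodule L E, K ≤ A ∧ U ≤ A ∧ K ≤ V ∧ Module.finrank L K = s ∧
      Module.finrank L A = c + s := by
  have key : ∃ K : Submodule L E, K ≤ V ∧ Module.finrank L K = s ∧
      Module.finrank L (U ⊔ K : Submodule L E) ≤ c + s := by
    rcases le_total s (Module.finrank L (U ⊓ V : Submodule L E)) with h | h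
    · obtain ⟨K, -, hK, hKs⟩ := Submodule.exists_finrank_eq_of_le (bot_le (a := U ⊓ V))
        (by simp) h
      refine ⟨K, hK.trans inf_le_right, hKs, ?_⟩
      rwa [sup_eq_left.2 (hK.trans inf_le_left)]
    · obtain ⟨K, hK1, hK2, hKs⟩ := Submodule.exists_finrank_eq_of_le
        (inf_le_right : U ⊓ V ≤ V) h hV
      refine ⟨K, hK2, hKs, ?_⟩
      have h1 := Submodule.finrank_sup_add_finrank_inf_eq U K
      have h2 : U ⊓ K = U ⊓ V := le_antisymm (inf_le_inf_left _ hK2) (le_inf inf_le_left hK1)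
      rw [h2] at h1
      omega
  obtain ⟨K, hKV, hKs, hsup⟩ := key
  obtain ⟨A, hA, -, hAd⟩ := Submodule.exists_finrank_eq_of_le (le_top (a := U ⊔ K)) hsup
    (by rwa [finrank_top])
  exact ⟨K, A, le_sup_right.trans hA, le_sup_left.trans hA, hKV, hKs, hAd⟩

/-- A flag `K ≤ A` admits an adapted basis. -/
theorem Submodule.exists_linearIndependent_of_flag {L E : Type*} [Field L] [AddCommGroup E]
    [Module L E] [FiniteDimensional L E] {K A : Submodule L E} (hKA : K ≤ A) {c s t : ℕ}
    (hK : Module.finrank L K = s) (hA : Module.finrank L A = c + s)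
    (hE : Module.finrank L E = c + s + t) :
    ∃ v : (Fin c ⊕ Fin s) ⊕ Fin t → E, LinearIndependent L v ∧
      (∀ j, v (Sum.inl (Sum.inr j)) ∈ K) ∧
      A = Submodule.span L (Set.range fun j => v (Sum.inl j)) := by
  obtain ⟨K', hK'⟩ := Submodule.exists_isCompl K
  obtain ⟨A', hA'⟩ := Submodule.exists_isCompl A
  have hsup : (K' ⊓ A) ⊔ K = A := by
    rw [inf_comm, inf_sup_assoc_of_le K' hKA, sup_comm, hK'.sup_eq_top, inf_top_eq]
  have hdisj : Disjoint (K' ⊓ A) K := hK'.disjoint.symm.mono_left inf_le_left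
  have h1 : Module.finrank L (K' ⊓ A : Submodule L E) = c := by
    have := Submodule.finrank_sup_add_finrank_inf_eq (K' ⊓ A) K
    rw [hsup, hdisj.eq_bot, finrank_bot] at this
    omega
  have h2 : Module.finrank L A' = t := by
    have := Submodule.finrank_add_eq_of_isCompl hA'
    omega
  let b1 := Module.finBasisOfFinrankEq L (K' ⊓ A : Submodule L E) h1
  let b2 := Module.finBasisOfFinrankEq L K hK
  let b3 := Module.finBasisOfFinrankEq L A' h2
  have hspan : ∀ {ι : Type} (B : Submodule L E) (b : Module.Basis ι L B),
      Submodule.span L (Set.range fun j => (b j : E)) = B := by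
    intro ι B b
    have := congrArg (Submodule.map B.subtype) b.span_eq
    rw [Submodule.map_span, ← Set.range_comp, Submodule.map_top, Submodule.range_subtype] at this
    exact this
  have hind : ∀ {ι : Type} (B : Submodule L E) (b : Module.Basis ι L B),
      LinearIndependent L fun j => (b j : E) := fun B b =>
    b.linearIndependent.map' B.subtype (Submodule.ker_subtype B)
  have hspanA : Submodule.span L (Set.range (Sum.elim (fun j => (b1 j : E))
      fun j => (b2 j : E))) = A := by
    rw [Set.Sum.elim_range, Submodule.span_union, hspan, hspan, hsup]
  refine ⟨Sum.elim (Sum.elim (fun j => (b1 j : E)) fun j => (b2 j : E)) fun j => (b3 j : E),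
    ?_, fun j => (b2 j).2, hspanA.symm⟩
  refine LinearIndependent.sum_type (LinearIndependent.sum_type (hind _ b1) (hind _ b2) ?_)
    (hind _ b3) ?_
  · rw [hspan, hspan]
    exact hdisj
  · rw [hspanA, hspan]
    exact hA'.disjoint

/-- The diagonal projection onto the first summand of `(C ⊕ S) ⊕ T`. -/
def Matrix.diagFst (C S T R : Type*) [DecidableEq C] [DecidableEq S] [DecidableEq T]
    [Zero R] [One R] : Matrix ((C ⊕ S) ⊕ T) ((C ⊕ S) ⊕ T) R :=
  Matrix.diagonal (Sum.elim (fun _ => 1) fun _ => 0)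

/-- The diagonal projection killing the middle summand of `(C ⊕ S) ⊕ T`. -/
def Matrix.diagOuter (C S T R : Type*) [DecidableEq C] [DecidableEq S] [DecidableEq T]
    [Zero R] [One R] : Matrix ((C ⊕ S) ⊕ T) ((C ⊕ S) ⊕ T) R :=
  Matrix.diagonal (Sum.elim (Sum.elim (fun _ => 1) fun _ => 0) fun _ => 1)

theorem Matrix.map_diagFst {C S T R R' : Type*} [DecidableEq C] [DecidableEq S] [DecidableEq T]
    [Semiring R] [Semiring R'] (f : R →+* R') :
    (Matrix.diagFst C S T R).map f = Matrix.diagFst C S T R' := by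
  rw [diagFst, diagFst, Matrix.diagonal_map (map_zero f)]
  congr 1
  funext j
  rcases j with (_ | _) | _ <;> simp

theorem Matrix.map_diagOuter {C S T R R' : Type*} [DecidableEq C] [DecidableEq S] [DecidableEq T]
    [Semiring R] [Semiring R'] (f : R →+* R') :
    (Matrix.diagOuter C S T R).map f = Matrix.diagOuter C S T R' := by
  rw [diagOuter, diagOuter, Matrix.diagonal_map (map_zero f)]
  congr 1
  funext j
  rcases j with (_ | _) | _ <;> simp

theorem Matrix.rank_diagonal_eq_sum {L ι : Type*} [Field L] [Fintype ι] [DecidableEq ι]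
    [DecidableEq L] (w : ι → L) :
    (Matrix.diagonal w).rank = ∑ j, if w j ≠ 0 then 1 else 0 := by
  rw [Matrix.rank_diagonal, Fintype.card_subtype, Finset.card_filter]

section Factorization

variable {L C S T M N : Type*} [Field L] [Fintype C] [Fintype S] [Fintype T] [Fintype M]
  [DecidableEq C] [DecidableEq S] [DecidableEq T]

theorem Matrix.rank_mul_diagFst_mul_le (g : Matrix ((C ⊕ S) ⊕ T) ((C ⊕ S) ⊕ T) L)
    (x : Matrix ((C ⊕ S) ⊕ T) M L) :
    (g * Matrix.diagFst C S T L * x).rank ≤ Fintype.card C + Fintype.card S := by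
  classical
  refine (Matrix.rank_mul_le_left _ _).trans ((Matrix.rank_mul_le_right _ _).trans ?_)
  rw [diagFst, Matrix.rank_diagonal_eq_sum]
  simp [Fintype.sum_sum_type]

theorem Matrix.rank_mul_diagOuter_mul_le (g : Matrix ((C ⊕ S) ⊕ T) ((C ⊕ S) ⊕ T) L)
    (y : Matrix N ((C ⊕ S) ⊕ T) L) :
    (y * Matrix.diagOuter C S T L * g).rank ≤ Fintype.card C + Fintype.card T := by
  classical
  refine (Matrix.rank_mul_le_left _ _).trans ((Matrix.rank_mul_le_right _ _).trans ?_)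
  rw [diagOuter, Matrix.rank_diagonal_eq_sum]
  simp [Fintype.sum_sum_type]

theorem Matrix.rank_mul_adjugate_mul_le (g : Matrix ((C ⊕ S) ⊕ T) ((C ⊕ S) ⊕ T) L)
    (x : Matrix ((C ⊕ S) ⊕ T) M L) (y : Matrix N ((C ⊕ S) ⊕ T) L) :
    ((y * Matrix.diagOuter C S T L * g.adjugate) * (g * Matrix.diagFst C S T L * x)).rank ≤
      Fintype.card C := by
  classical
  have h : (y * Matrix.diagOuter C S T L * g.adjugate) * (g * Matrix.diagFst C S T L * x) =
      y * (Matrix.diagOuter C S T L * Matrix.diagFst C S T L) * (g.det • x) := by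
    calc _ = y * Matrix.diagOuter C S T L * (g.adjugate * g) * Matrix.diagFst C S T L * x := by
            simp only [Matrix.mul_assoc]
      _ = _ := by
            rw [Matrix.adjugate_mul]
            simp [Matrix.mul_assoc]
  rw [h]
  refine (Matrix.rank_mul_le_left _ _).trans ((Matrix.rank_mul_le_right _ _).trans ?_)
  rw [diagOuter, diagFst, Matrix.diagonal_mul_diagonal, Matrix.rank_diagonal_eq_sum,
    Fintype.sum_sum_type, Fintype.sum_sum_type]
  simp

end Factorization

open scoped Matrix in
/-- A pair of composable matrices with bounded ranks is simultaneously put in a normal form. -/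
theorem Matrix.exists_factorization {L M N : Type*} [Field L] [Fintype M] [Fintype N] {c s t : ℕ}
    (α : Matrix ((Fin c ⊕ Fin s) ⊕ Fin t) M L) (β : Matrix N ((Fin c ⊕ Fin s) ⊕ Fin t) L)
    (hα : α.rank ≤ c + s) (hβ : β.rank ≤ c + t) (hβα : (β * α).rank ≤ c) :
    ∃ (g : Matrix ((Fin c ⊕ Fin s) ⊕ Fin t) ((Fin c ⊕ Fin s) ⊕ Fin t) L)
      (x : Matrix ((Fin c ⊕ Fin s) ⊕ Fin t) M L) (y : Matrix N ((Fin c ⊕ Fin s) ⊕ Fin t) L),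
      α = g * Matrix.diagFst (Fin c) (Fin s) (Fin t) L * x ∧
      β = y * Matrix.diagOuter (Fin c) (Fin s) (Fin t) L * g.adjugate := by
  have hE : Module.finrank L ((Fin c ⊕ Fin s) ⊕ Fin t → L) = c + s + t := by simp
  have hker := LinearMap.finrank_range_add_finrank_ker β.mulVecLin
  have hmap := LinearMap.finrank_range_add_finrank_ker (β.mulVecLin.domRestrict α.mulVecLin.range)
  have hk : Module.finrank L (β.mulVecLin.domRestrict α.mulVecLin.range).ker =
      Module.finrank L (α.mulVecLin.range ⊓ β.mulVecLin.ker : Submodule L _) := by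
    have h : (β.mulVecLin.domRestrict α.mulVecLin.range).ker.map α.mulVecLin.range.subtype =
        α.mulVecLin.range ⊓ β.mulVecLin.ker := by
      rw [LinearMap.ker_domRestrict, Submodule.map_comap_subtype]
    rw [← h, Submodule.finrank_map_subtype_eq]
  have hr : Module.finrank L (β.mulVecLin.domRestrict α.mulVecLin.range).range =
      (β * α).rank := by
    rw [Matrix.rank, Matrix.mulVecLin_mul, LinearMap.range_domRestrict, LinearMap.range_comp]
  rw [hk, hr] at hmap
  rw [hE] at hker
  change β.rank + _ = _ at hker
  change _ = α.rank at hmap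
  obtain ⟨K, A, hKA, hUA, hKV, hK, hA⟩ := Submodule.exists_flag α.mulVecLin.range
    β.mulVecLin.ker (c := c) (s := s) hα (by omega) (by change α.rank ≤ _; omega) (by omega)
  obtain ⟨v, hv, hvK, hvA⟩ := Submodule.exists_linearIndependent_of_flag hKA hK hA hE
  let g : Matrix ((Fin c ⊕ Fin s) ⊕ Fin t) ((Fin c ⊕ Fin s) ⊕ Fin t) L :=
    Matrix.of fun i j => v j i
  have hg : IsUnit g.det := by
    rw [← Matrix.isUnit_iff_isUnit_det, ← Matrix.linearIndependent_cols_iff_isUnit]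
    exact hv
  have hcol : ∀ q, ∃ w : Fin c ⊕ Fin s → L, ∑ j, w j • v (Sum.inl j) = α.col q := by
    intro q
    have : α.col q ∈ A := hUA (by
      rw [Matrix.range_mulVecLin]
      exact Submodule.subset_span ⟨q, rfl⟩)
    rwa [hvA, Submodule.mem_span_range_iff_exists_fun] at this
  choose w hw using hcol
  refine ⟨g, Matrix.of fun j q => Sum.elim (w q) 0 j, g.det⁻¹ • (β * g), ?_, ?_⟩
  · ext i q
    have := congrFun (hw q) i
    simp only [Matrix.col_apply, Finset.sum_apply, Pi.smul_apply, smul_eq_mul] at this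
    rw [← this, Matrix.diagFst, Matrix.mul_apply]
    simp only [Matrix.mul_diagonal, Fintype.sum_sum_type, g]
    simp [mul_comm]
  · have h1 : β * g * Matrix.diagOuter (Fin c) (Fin s) (Fin t) L = β * g := by
      ext i j
      rw [Matrix.diagOuter, Matrix.mul_diagonal]
      rcases j with (j | j) | j
      · simp
      · have : β *ᵥ v (Sum.inl (Sum.inr j)) = 0 := hKV (hvK j)
        have h0 : (β * g) i (Sum.inl (Sum.inr j)) = 0 := congrFun this i
        simp [h0]
      · simp
    rw [Matrix.smul_mul, h1, Matrix.smul_mul, Matrix.mul_assoc, Matrix.mul_adjugate,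
      Matrix.mul_smul, smul_smul, inv_mul_cancel₀ hg.ne_zero]
    simp

/-- The ideal of the locus of pairs `(α, β)` with `rank α < p`, `rank β < q`,
`rank (β * α) < u`. -/
def genericRankIdeal (k : Type*) [Field k] (r m n p q u : ℕ) :
    Ideal (MvPolynomial ((Fin r × Fin m) ⊕ (Fin n × Fin r)) k) :=
  (genericAlpha k r m n).minorsIdeal p ⊔ (genericBeta k r m n).minorsIdeal q ⊔
    (genericBeta k r m n * genericAlpha k r m n).minorsIdeal u

theorem genericRankIdeal_le_ker_iff {k L : Type*} [Field k] [Field L] {r m n p q u : ℕ}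
    (f : MvPolynomial ((Fin r × Fin m) ⊕ (Fin n × Fin r)) k →+* L) :
    genericRankIdeal k r m n p q u ≤ RingHom.ker f ↔
      ((genericAlpha k r m n).map f).rank < p ∧ ((genericBeta k r m n).map f).rank < q ∧
        ((genericBeta k r m n).map f * (genericAlpha k r m n).map f).rank < u := by
  rw [genericRankIdeal, sup_le_iff, sup_le_iff, Matrix.minorsIdeal_le_ker_iff,
    Matrix.minorsIdeal_le_ker_iff, Matrix.minorsIdeal_le_ker_iff, Matrix.map_mul, and_assoc]

/-- The coordinates of a pair of matrices. -/
def matrixPairCoord {L : Type*} {r m n : ℕ} (α : Matrix (Fin r) (Fin m) L)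
    (β : Matrix (Fin n) (Fin r) L) : (Fin r × Fin m) ⊕ (Fin n × Fin r) → L :=
  Sum.elim (fun p => α p.1 p.2) fun p => β p.1 p.2

theorem genericAlpha_map_aeval {k L : Type*} [Field k] [CommRing L] [Algebra k L] {r m n : ℕ}
    (α : Matrix (Fin r) (Fin m) L) (β : Matrix (Fin n) (Fin r) L) :
    (genericAlpha k r m n).map (MvPolynomial.aeval (R := k) (matrixPairCoord α β)) = α := by
  ext i j
  simp [genericAlpha, matrixPairCoord]

theorem genericBeta_map_aeval {k L : Type*} [Field k] [CommRing L] [Algebra k L] {r m n : ℕ}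
    (α : Matrix (Fin r) (Fin m) L) (β : Matrix (Fin n) (Fin r) L) :
    (genericBeta k r m n).map (MvPolynomial.aeval (R := k) (matrixPairCoord α β)) = β := by
  ext i j
  simp [genericBeta, matrixPairCoord]

section Parametrization

variable {m n c s t : ℕ}

/-- The pair of matrices obtained from the triple of matrices `(g, x, y)`, as a point. -/
def factorizationPoint {L : Type*} [CommRing L] {r : ℕ} (e : (Fin c ⊕ Fin s) ⊕ Fin t ≃ Fin r)
    (g : Matrix ((Fin c ⊕ Fin s) ⊕ Fin t) ((Fin c ⊕ Fin s) ⊕ Fin t) L)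
    (x : Matrix ((Fin c ⊕ Fin s) ⊕ Fin t) (Fin m) L)
    (y : Matrix (Fin n) ((Fin c ⊕ Fin s) ⊕ Fin t) L) :
    (Fin r × Fin m) ⊕ (Fin n × Fin r) → L :=
  matrixPairCoord ((g * Matrix.diagFst (Fin c) (Fin s) (Fin t) L * x).submatrix e.symm id)
    ((y * Matrix.diagOuter (Fin c) (Fin s) (Fin t) L * g.adjugate).submatrix id e.symm)

theorem map_factorizationPoint {L L' : Type*} [CommRing L] [CommRing L'] {r : ℕ}
    (f : L →+* L') (e : (Fin c ⊕ Fin s) ⊕ Fin t ≃ Fin r)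
    (g : Matrix ((Fin c ⊕ Fin s) ⊕ Fin t) ((Fin c ⊕ Fin s) ⊕ Fin t) L)
    (x : Matrix ((Fin c ⊕ Fin s) ⊕ Fin t) (Fin m) L)
    (y : Matrix (Fin n) ((Fin c ⊕ Fin s) ⊕ Fin t) L) :
    f ∘ factorizationPoint e g x y =
      factorizationPoint e (g.map f) (x.map f) (y.map f) := by
  have hadj : (g.map f).adjugate = g.adjugate.map f := by
    have := f.map_adjugate g
    rw [RingHom.mapMatrix_apply, RingHom.mapMatrix_apply] at this
    exact this.symm
  rw [factorizationPoint, factorizationPoint, hadj, ← Matrix.map_diagFst f,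
    ← Matrix.map_diagOuter f, ← Matrix.map_mul, ← Matrix.map_mul, ← Matrix.map_mul,
    ← Matrix.map_mul]
  funext p
  rcases p with p | p <;> rfl

theorem genericRankIdeal_le_ker_aeval_factorizationPoint {k L : Type*} [Field k] [Field L]
    [Algebra k L] {r : ℕ} (e : (Fin c ⊕ Fin s) ⊕ Fin t ≃ Fin r)
    (g : Matrix ((Fin c ⊕ Fin s) ⊕ Fin t) ((Fin c ⊕ Fin s) ⊕ Fin t) L)
    (x : Matrix ((Fin c ⊕ Fin s) ⊕ Fin t) (Fin m) L)
    (y : Matrix (Fin n) ((Fin c ⊕ Fin s) ⊕ Fin t) L) :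
    genericRankIdeal k r m n (c + s + 1) (c + t + 1) (c + 1) ≤
      RingHom.ker (MvPolynomial.aeval (R := k) (factorizationPoint e g x y)).toRingHom := by
  rw [genericRankIdeal_le_ker_iff]
  simp only [AlgHom.toRingHom_eq_coe, RingHom.coe_coe, factorizationPoint,
    genericAlpha_map_aeval, genericBeta_map_aeval]
  refine ⟨?_, ?_, ?_⟩
  · rw [Nat.lt_succ_iff]
    refine (Matrix.rank_submatrix_le _ _ _).trans ?_
    simpa using Matrix.rank_mul_diagFst_mul_le g x
  · rw [Nat.lt_succ_iff]
    refine (Matrix.rank_submatrix_le _ _ _).trans ?_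
    simpa using Matrix.rank_mul_diagOuter_mul_le g.adjugate y
  · rw [Nat.lt_succ_iff, Matrix.submatrix_mul_equiv]
    refine (Matrix.rank_submatrix_le _ _ _).trans ?_
    simpa using Matrix.rank_mul_adjugate_mul_le g x y

theorem exists_eq_factorizationPoint {k : Type*} [Field k] {r : ℕ}
    (e : (Fin c ⊕ Fin s) ⊕ Fin t ≃ Fin r) (z : (Fin r × Fin m) ⊕ (Fin n × Fin r) → k)
    (hz : genericRankIdeal k r m n (c + s + 1) (c + t + 1) (c + 1) ≤
      RingHom.ker (MvPolynomial.aeval (R := k) z).toRingHom) :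
    ∃ g x y, z = factorizationPoint e g x y := by
  obtain ⟨α, β, rfl⟩ : ∃ α β, z = matrixPairCoord α β :=
    ⟨Matrix.of fun i j => z (Sum.inl (i, j)), Matrix.of fun i j => z (Sum.inr (i, j)), by
      funext p
      rcases p with p | p <;> rfl⟩
  rw [genericRankIdeal_le_ker_iff] at hz
  simp only [AlgHom.toRingHom_eq_coe, RingHom.coe_coe, genericAlpha_map_aeval,
    genericBeta_map_aeval, Nat.lt_succ_iff] at hz
  obtain ⟨hα, hβ, hβα⟩ := hz
  obtain ⟨g, x, y, hx, hy⟩ := Matrix.exists_factorization (α.submatrix e id) (β.submatrix id e)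
    ((Matrix.rank_submatrix_le _ _ _).trans hα) ((Matrix.rank_submatrix_le _ _ _).trans hβ)
    (by
      rw [Matrix.submatrix_mul_equiv]
      exact (Matrix.rank_submatrix_le _ _ _).trans hβα)
  refine ⟨g, x, y, ?_⟩
  rw [factorizationPoint, ← hx, ← hy]
  simp

/-- The radical of the ideal of the rank locus is prime, being the kernel of a parametrization. -/
theorem genericRankIdeal_radical_isPrime {k : Type*} [Field k] [IsAlgClosed k] {r : ℕ}
    (e : (Fin c ⊕ Fin s) ⊕ Fin t ≃ Fin r) :
    (genericRankIdeal k r m n (c + s + 1) (c + t + 1) (c + 1)).radical.IsPrime := by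
  let ι := (Fin c ⊕ Fin s) ⊕ Fin t
  let R := MvPolynomial ((ι × ι) ⊕ ((ι × Fin m) ⊕ (Fin n × ι))) k
  let g : Matrix ι ι R := Matrix.of fun i j => MvPolynomial.X (Sum.inl (i, j))
  let x : Matrix ι (Fin m) R := Matrix.of fun i j => MvPolynomial.X (Sum.inr (Sum.inl (i, j)))
  let y : Matrix (Fin n) ι R := Matrix.of fun i j => MvPolynomial.X (Sum.inr (Sum.inr (i, j)))
  let φ := MvPolynomial.aeval (R := k) (factorizationPoint e g x y)
  have hprime : (RingHom.ker φ).IsPrime := RingHom.ker_isPrime φ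
  suffices h : (genericRankIdeal k r m n (c + s + 1) (c + t + 1) (c + 1)).radical =
      RingHom.ker φ by rwa [h]
  apply le_antisymm
  · rw [hprime.radical_le_iff]
    intro f hf
    have h := genericRankIdeal_le_ker_aeval_factorizationPoint (k := k) e
      (g.map (algebraMap R (FractionRing R))) (x.map (algebraMap R (FractionRing R)))
      (y.map (algebraMap R (FractionRing R))) hf
    rw [← map_factorizationPoint] at h
    have h2 : algebraMap R (FractionRing R) (φ f) = 0 := by
      rw [← MvPolynomial.aeval_algebraMap_apply]
      exact h
    exact (FaithfulSMul.algebraMap_eq_zero_iff R (FractionRing R)).1 h2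
  · intro f hf
    rw [← MvPolynomial.vanishingIdeal_zeroLocus_eq_radical (K := k)]
    rw [MvPolynomial.mem_vanishingIdeal_iff]
    intro z hz
    obtain ⟨g', x', y', rfl⟩ := exists_eq_factorizationPoint e z fun p hp => hz p hp
    let ψ : R →ₐ[k] k := MvPolynomial.aeval (Sum.elim (fun p => g' p.1 p.2)
      (Sum.elim (fun p => x' p.1 p.2) fun p => y' p.1 p.2))
    have hg : g.map ψ.toRingHom = g' := by
      ext i j
      exact MvPolynomial.aeval_X _ _
    have hx : x.map ψ.toRingHom = x' := by
      ext i j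
      exact MvPolynomial.aeval_X _ _
    have hy : y.map ψ.toRingHom = y' := by
      ext i j
      exact MvPolynomial.aeval_X _ _
    rw [← hg, ← hx, ← hy, ← map_factorizationPoint]
    have h2 : ψ (φ f) = 0 := by
      rw [(hf : φ f = 0), map_zero]
    rw [← AlgHom.comp_apply, MvPolynomial.comp_aeval] at h2
    exact h2

end Parametrization

section Blocks

variable {L A T M C V : Type*} [Field L] [Fintype A] [Fintype T] [Fintype M] [Fintype C]
  [DecidableEq A] [DecidableEq C]

/-- In a matrix whose rank equals the size of an invertible block, the remaining rows are
determined by the rows and columns through that block. -/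
theorem Matrix.submatrix_inr_eq_of_rank_le [Fintype V] (X : Matrix (C ⊕ V) M L) (h : C → M)
    (hX : X.rank ≤ Fintype.card C) (hdet : (X.submatrix Sum.inl h).det ≠ 0) :
    X.submatrix Sum.inr id =
      X.submatrix Sum.inr h * (X.submatrix Sum.inl h)⁻¹ * X.submatrix Sum.inl id := by
  have hunit : IsUnit (X.submatrix Sum.inl h).det := hdet.isUnit
  have hspan : Submodule.span L (Set.range (X.submatrix Sum.inl id).row) =
      Submodule.span L (Set.range X.row) := by
    apply Submodule.eq_of_le_of_finrank_le
    · refine Submodule.span_mono ?_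
      rintro _ ⟨i, rfl⟩
      exact ⟨Sum.inl i, rfl⟩
    · rw [← Matrix.rank_eq_finrank_span_row, ← Matrix.rank_eq_finrank_span_row]
      refine hX.trans ?_
      rw [← Matrix.rank_of_det_ne_zero hdet]
      exact Matrix.rank_submatrix_le (X.submatrix Sum.inl id) id h
  have hcomb : ∀ i : V, ∃ w : C → L, ∑ j, w j • (X.submatrix Sum.inl id).row j =
      X.row (Sum.inr i) := by
    intro i
    rw [← Submodule.mem_span_range_iff_exists_fun, hspan]
    exact Submodule.subset_span ⟨_, rfl⟩
  choose w hw using hcomb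
  have hW : X.submatrix Sum.inr id = Matrix.of w * X.submatrix Sum.inl id := by
    ext i j
    have := congrFun (hw i) j
    simp only [Finset.sum_apply, Pi.smul_apply, smul_eq_mul] at this
    rw [Matrix.mul_apply]
    exact this.symm
  have hW' : X.submatrix Sum.inr h = Matrix.of w * X.submatrix Sum.inl h := by
    ext i j
    exact congrFun (congrFun hW i) (h j)
  rw [hW', Matrix.mul_assoc (Matrix.of w), Matrix.mul_nonsing_inv _ hunit, Matrix.mul_one, hW]

/-- A pair `(α, β)` with prescribed blocks in general position and smallest possible ranks. -/
theorem Matrix.exists_pair_of_blocks [DecidableEq T] (hM : A → M) (hA : C → A) (At : Matrix A M L)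
    (A21 : Matrix T A L) (B2 : Matrix (C ⊕ V) T L) (Bt : Matrix C A L) (B21 : Matrix V C L)
    (h1 : (At.submatrix id hM).det ≠ 0)
    (h2 : ((Bt + B2.submatrix Sum.inl id * A21 * (At.submatrix id hM)⁻¹).submatrix id hA).det
      ≠ 0) :
    ∃ (α : Matrix (A ⊕ T) M L) (β : Matrix (C ⊕ V) (A ⊕ T) L),
      (α.rank ≤ Fintype.card A ∧ β.rank ≤ Fintype.card C + Fintype.card T ∧
        (β * α).rank ≤ Fintype.card C) ∧
      α.submatrix Sum.inl id = At ∧ α.submatrix Sum.inr hM = A21 ∧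
      β.submatrix id Sum.inr = B2 ∧ β.submatrix Sum.inl Sum.inl = Bt ∧
      β.submatrix Sum.inr (Sum.inl ∘ hA) = B21 := by
  set X := A21 * (At.submatrix id hM)⁻¹ with hX
  rw [Matrix.mul_assoc, ← hX] at h2
  set Γt := Bt + B2.submatrix Sum.inl id * X with hΓt
  set Y := (B21 + B2.submatrix Sum.inr id * X.submatrix id hA) * (Γt.submatrix id hA)⁻¹ with hY
  have hXA : X * At.submatrix id hM = A21 := by
    rw [hX, Matrix.mul_assoc, Matrix.nonsing_inv_mul _ h1.isUnit, Matrix.mul_one]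
  have hYΓ : Y * Γt.submatrix id hA = B21 + B2.submatrix Sum.inr id * X.submatrix id hA := by
    rw [hY, Matrix.mul_assoc, Matrix.nonsing_inv_mul _ h2.isUnit, Matrix.mul_one]
  have hβ : Matrix.fromCols (Matrix.fromRows 1 Y * Γt - B2 * X) B2 =
      Matrix.fromCols (Matrix.fromRows 1 Y) B2 * Matrix.fromBlocks Γt 0 (-X) 1 := by
    rw [Matrix.fromCols_mul_fromBlocks]
    simp [sub_eq_add_neg]
  have hα : Matrix.fromRows At (X * At) = Matrix.fromRows 1 X * At := by
    rw [Matrix.fromRows_mul, Matrix.one_mul]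
  refine ⟨Matrix.fromRows At (X * At),
    Matrix.fromCols (Matrix.fromRows 1 Y * Γt - B2 * X) B2, ⟨?_, ?_, ?_⟩, ?_, ?_, ?_, ?_, ?_⟩
  · rw [hα]
    exact (Matrix.rank_mul_le_left _ _).trans (Matrix.rank_le_card_width _)
  · rw [hβ]
    refine (Matrix.rank_mul_le_left _ _).trans ((Matrix.rank_le_card_width _).trans ?_)
    simp
  · rw [Matrix.fromCols_mul_fromRows]
    have : (Matrix.fromRows 1 Y * Γt - B2 * X) * At + B2 * (X * At) =
        Matrix.fromRows 1 Y * (Γt * At) := by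
      rw [Matrix.sub_mul, Matrix.mul_assoc, Matrix.mul_assoc, sub_add_cancel]
    rw [this]
    exact (Matrix.rank_mul_le_left _ _).trans (Matrix.rank_le_card_width _)
  · ext i j
    rfl
  · rw [← hXA]
    rfl
  · ext i j
    rfl
  · have : (Matrix.fromCols (Matrix.fromRows 1 Y * Γt - B2 * X) B2).submatrix Sum.inl Sum.inl =
        Γt - B2.submatrix Sum.inl id * X := by
      rw [Matrix.fromRows_mul, Matrix.one_mul]
      ext i j
      rfl
    rw [this, hΓt, add_sub_cancel_right]
  · have : (Matrix.fromCols (Matrix.fromRows 1 Y * Γt - B2 * X) B2).submatrix Sum.inr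
        (Sum.inl ∘ hA) =
        Y * Γt.submatrix id hA - B2.submatrix Sum.inr id * X.submatrix id hA := by
      rw [Matrix.fromRows_mul, Matrix.one_mul]
      ext i j
      rfl
    rw [this, hYΓ, add_sub_cancel_right]

/-- A pair `(α, β)` of minimal ranks is determined by its blocks in general position. -/
theorem Matrix.pair_ext_of_blocks [Fintype V] (hM : A → M) (hA : C → A)
    {α α' : Matrix (A ⊕ T) M L} {β β' : Matrix (C ⊕ V) (A ⊕ T) L}
    (hα : α.rank ≤ Fintype.card A) (hβα : (β * α).rank ≤ Fintype.card C)
    (hα' : α'.rank ≤ Fintype.card A) (hβα' : (β' * α').rank ≤ Fintype.card C)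
    (h1 : (α.submatrix Sum.inl hM).det ≠ 0)
    (h2 : ((β.submatrix Sum.inl Sum.inl + β.submatrix Sum.inl Sum.inr * α.submatrix Sum.inr hM *
      (α.submatrix Sum.inl hM)⁻¹).submatrix id hA).det ≠ 0)
    (hAt : α.submatrix Sum.inl id = α'.submatrix Sum.inl id)
    (hA21 : α.submatrix Sum.inr hM = α'.submatrix Sum.inr hM)
    (hB2 : β.submatrix id Sum.inr = β'.submatrix id Sum.inr)
    (hBt : β.submatrix Sum.inl Sum.inl = β'.submatrix Sum.inl Sum.inl)
    (hB21 : β.submatrix Sum.inr (Sum.inl ∘ hA) = β'.submatrix Sum.inr (Sum.inl ∘ hA)) :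
    α = α' ∧ β = β' := by
  have hA11 : α.submatrix Sum.inl hM = α'.submatrix Sum.inl hM :=
    congrArg (fun X : Matrix A M L => X.submatrix id hM) hAt
  have e : α = α' := by
    have e1 := Matrix.submatrix_inr_eq_of_rank_le α hM hα h1
    have e2 := Matrix.submatrix_inr_eq_of_rank_le α' hM hα' (hA11 ▸ h1)
    rw [hA21, hA11, hAt, ← e2] at e1
    ext i j
    rcases i with i | i
    · exact congrFun (congrFun hAt i) j
    · exact congrFun (congrFun e1 i) j
  subst e
  refine ⟨rfl, ?_⟩
  set X := α.submatrix Sum.inr hM * (α.submatrix Sum.inl hM)⁻¹ with hX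
  have hrank : ∀ δ : Matrix (C ⊕ V) (A ⊕ T) L, (δ * α).rank ≤ Fintype.card C →
      (δ.submatrix id Sum.inl + δ.submatrix id Sum.inr * X).rank ≤ Fintype.card C := by
    intro δ hδ
    have h : δ.submatrix id Sum.inl + δ.submatrix id Sum.inr * X =
        (δ * α).submatrix id hM * (α.submatrix Sum.inl hM)⁻¹ := by
      have h0 : (δ * α).submatrix id hM = δ.submatrix id Sum.inl * α.submatrix Sum.inl hM +
          δ.submatrix id Sum.inr * α.submatrix Sum.inr hM := by
        ext i j
        simp [Matrix.mul_apply, Fintype.sum_sum_type]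
      rw [h0, Matrix.add_mul, Matrix.mul_assoc, Matrix.mul_nonsing_inv _ h1.isUnit,
        Matrix.mul_one, hX, Matrix.mul_assoc]
    rw [h]
    exact (Matrix.rank_mul_le_left _ _).trans ((Matrix.rank_submatrix_le _ _ _).trans hδ)
  have hγ := hrank β hβα
  have hγ' := hrank β' hβα'
  rw [Matrix.mul_assoc, ← hX] at h2
  set Γ := β.submatrix id Sum.inl + β.submatrix id Sum.inr * X with hΓ
  set Γ' := β'.submatrix id Sum.inl + β'.submatrix id Sum.inr * X with hΓ'
  have ht : Γ.submatrix Sum.inl id = Γ'.submatrix Sum.inl id := by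
    rw [hΓ, hΓ', hB2]
    ext i j
    simpa using congrFun (congrFun hBt i) j
  have h11 : Γ.submatrix Sum.inl hA = Γ'.submatrix Sum.inl hA :=
    congrArg (fun X : Matrix C A L => X.submatrix id hA) ht
  have h21 : Γ.submatrix Sum.inr hA = Γ'.submatrix Sum.inr hA := by
    rw [hΓ, hΓ', hB2]
    ext i j
    simpa using congrFun (congrFun hB21 i) j
  have hdet : (Γ.submatrix Sum.inl hA).det ≠ 0 := h2
  have e1 := Matrix.submatrix_inr_eq_of_rank_le Γ hA hγ hdet
  have e2 := Matrix.submatrix_inr_eq_of_rank_le Γ' hA hγ' (h11 ▸ hdet)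
  rw [h21, h11, ht, ← e2] at e1
  have hΓΓ : Γ = Γ' := by
    ext i j
    rcases i with i | i
    · exact congrFun (congrFun ht i) j
    · exact congrFun (congrFun e1 i) j
  rw [hΓ, hΓ', hB2] at hΓΓ
  have hleft := add_right_cancel hΓΓ
  ext i j
  rcases j with j | j
  · exact congrFun (congrFun hleft i) j
  · exact congrFun (congrFun hB2 i) j

end Blocks

/-- If a prime ideal `P` has, over every field extension of the base field, exactly one point over
every choice of the coordinates in `τ` that lies off the hypersurface `G = 0`, then the coordinate
ring of `P` has dimension the number of these coordinates. -/
theorem MvPolynomial.ringKrullDim_quotient_eq_card.{u} {k : Type u} {σ τ : Type} [Field k]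
    [Finite σ] [Fintype τ] (P : Ideal (MvPolynomial σ k)) [P.IsPrime] (φ : τ → σ)
    (G : MvPolynomial τ k) (hG : G ≠ 0)
    (h : ∀ (L : Type u) [Field L] [Algebra k L] (w : τ → L), MvPolynomial.aeval w G ≠ 0 →
      ∃! z : σ → L, z ∘ φ = w ∧ P ≤ RingHom.ker (MvPolynomial.aeval (R := k) z)) :
    ringKrullDim (MvPolynomial σ k ⧸ P) = Fintype.card τ := by
  set x : τ → MvPolynomial σ k ⧸ P := fun i => Ideal.Quotient.mkₐ k P (MvPolynomial.X (φ i))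
    with hx
  let K := FractionRing (MvPolynomial τ k)
  have haevK : MvPolynomial.aeval (R := k) (fun i => algebraMap (MvPolynomial τ k) K
      (MvPolynomial.X i)) = Algebra.algHom k (MvPolynomial τ k) K := by
    exact MvPolynomial.algHom_ext fun i => MvPolynomial.aeval_X _ _
  have hinjK : Function.Injective (algebraMap (MvPolynomial τ k) K) :=
    IsFractionRing.injective _ _
  obtain ⟨zK, ⟨hzK, hPK⟩, -⟩ := h K (fun i => algebraMap (MvPolynomial τ k) K (MvPolynomial.X i))
    (by
      rw [haevK]
      exact (map_ne_zero_iff _ hinjK).mpr hG)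
  have hind : AlgebraicIndependent k x := by
    refine AlgebraicIndependent.of_comp
      (Ideal.Quotient.liftₐ P (MvPolynomial.aeval (R := k) zK) fun p hp => hPK hp) ?_
    have hcomp : (Ideal.Quotient.liftₐ P (MvPolynomial.aeval (R := k) zK) fun p hp => hPK hp) ∘ x =
        fun i => algebraMap (MvPolynomial τ k) K (MvPolynomial.X i) := by
      rw [← hzK]
      funext i
      exact MvPolynomial.aeval_X _ _
    rw [hcomp, AlgebraicIndependent, haevK]
    exact hinjK
  let L := FractionRing (MvPolynomial σ k ⧸ P)
  have hinjL : Function.Injective (algebraMap (MvPolynomial σ k ⧸ P) L) :=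
    IsFractionRing.injective _ _
  let f : MvPolynomial τ k →ₐ[k] L := MvPolynomial.aeval fun i => algebraMap _ L (x i)
  have hfx : ∀ p, f p = algebraMap _ L (MvPolynomial.aeval x p) := by
    intro p
    exact MvPolynomial.aeval_algebraMap_apply _ _ _
  have hf : Function.Injective f := by
    intro p q hpq
    rw [hfx, hfx] at hpq
    exact hind (hinjL hpq)
  let fK : K →ₐ[k] L := IsFractionRing.liftAlgHom hf
  have hfK : ∀ p, fK (algebraMap _ K p) = f p := fun p => IsFractionRing.lift_algebraMap hf p
  let g : MvPolynomial σ k →ₐ[k] L :=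
    (Algebra.algHom k (MvPolynomial σ k ⧸ P) L).comp (Ideal.Quotient.mkₐ k P)
  have hg : MvPolynomial.aeval (fun j => g (MvPolynomial.X j)) = g :=
    MvPolynomial.algHom_ext fun i => MvPolynomial.aeval_X _ _
  have hgK : MvPolynomial.aeval (fK ∘ zK) = fK.comp (MvPolynomial.aeval (R := k) zK) :=
    MvPolynomial.algHom_ext fun i => by simp
  have hz : (fun j => g (MvPolynomial.X j)) = fK ∘ zK := by
    refine (h L (fun i => algebraMap _ L (x i)) ((map_ne_zero_iff f hf).mpr hG)).unique
      ⟨rfl, ?_⟩ ⟨?_, ?_⟩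
    · rw [hg]
      intro p hp
      have : Ideal.Quotient.mkₐ k P p = 0 := Ideal.Quotient.eq_zero_iff_mem.mpr hp
      rw [RingHom.mem_ker, AlgHom.comp_apply, this, map_zero]
    · funext i
      have := congrFun hzK i
      simp only [Function.comp_apply] at this ⊢
      rw [this, hfK]
      exact MvPolynomial.aeval_X _ _
    · rw [hgK]
      intro p hp
      rw [RingHom.mem_ker, AlgHom.comp_apply, RingHom.mem_ker.mp (hPK hp), map_zero]
  have htr : IsTranscendenceBasis k x := by
    rw [hind.isTranscendenceBasis_iff_isAlgebraic]
    constructor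
    intro a
    obtain ⟨κ, hκ⟩ : ∃ κ, algebraMap _ L a = fK κ := by
      obtain ⟨p, rfl⟩ := Ideal.Quotient.mk_surjective a
      refine ⟨MvPolynomial.aeval zK p, ?_⟩
      rw [← AlgHom.comp_apply, ← hgK, ← hz, hg]
      rfl
    obtain ⟨p, q, hq, rfl⟩ := IsFractionRing.div_surjective (A := MvPolynomial τ k) κ
    have hq0 : q ≠ 0 := nonZeroDivisors.ne_zero hq
    have hrel : a * MvPolynomial.aeval x q = MvPolynomial.aeval x p := by
      apply hinjL
      rw [map_mul, ← hfx, ← hfx, hκ, map_div₀, hfK, hfK,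
        div_mul_cancel₀ _ ((map_ne_zero_iff f hf).mpr hq0)]
    have hmem : ∀ p : MvPolynomial τ k,
        MvPolynomial.aeval x p ∈ Algebra.adjoin k (Set.range x) := by
      intro p
      rw [Algebra.adjoin_range_eq_range_aeval]
      exact ⟨p, rfl⟩
    refine ⟨Polynomial.C ⟨_, hmem q⟩ * Polynomial.X - Polynomial.C ⟨_, hmem p⟩, ?_, ?_⟩
    · intro h0
      have h1 : MvPolynomial.aeval x q = 0 := by
        have hc : (⟨_, hmem q⟩ : Algebra.adjoin k (Set.range x)) = 0 := by
          simpa [Polynomial.coeff_C] using congrArg (fun P => Polynomial.coeff P 1) h0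
        exact congrArg Subtype.val hc
      exact hq0 (hind (h1.trans (map_zero _).symm))
    · simp only [map_sub, map_mul, Polynomial.aeval_C, Polynomial.aeval_X]
      rw [mul_comm]
      exact sub_eq_zero.mpr hrel
  exact ringKrullDim_eq_card_of_isTranscendenceBasis htr

section FreeCoordinates

/-- The indices of the entries of a pair of block matrices that determine the pair. -/
abbrev FreeIndex (A T U C V : Type) : Type :=
  ((A × (A ⊕ U)) ⊕ (T × A)) ⊕ (((C ⊕ V) × T) ⊕ ((C × A) ⊕ (V × C)))

variable {A T U C V : Type}

/-- The entries of a pair of matrices that determine the pair, as coordinates on pairs. -/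
def freeCoord {r m n : ℕ} (er : A ⊕ T ≃ Fin r) (em : A ⊕ U ≃ Fin m) (en : C ⊕ V ≃ Fin n)
    (hA : C → A) : FreeIndex A T U C V → (Fin r × Fin m) ⊕ (Fin n × Fin r) :=
  Sum.elim
    (Sum.elim (fun p => Sum.inl (er (Sum.inl p.1), em p.2))
      fun p => Sum.inl (er (Sum.inr p.1), em (Sum.inl p.2)))
    (Sum.elim (fun p => Sum.inr (en p.1, er (Sum.inr p.2)))
      (Sum.elim (fun p => Sum.inr (en (Sum.inl p.1), er (Sum.inl p.2)))
        fun p => Sum.inr (en (Sum.inr p.1), er (Sum.inl (hA p.2)))))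

variable [Fintype A] [Fintype T] [Fintype C] [DecidableEq A] [DecidableEq C]

/-- The nonvanishing of this element means that the entries `w` are in general position. -/
def freeDet {R : Type*} [CommRing R] (hA : C → A) (w : FreeIndex A T U C V → R) : R :=
  let A11 : Matrix A A R := Matrix.of fun i j => w (Sum.inl (Sum.inl (i, Sum.inl j)))
  let A21 : Matrix T A R := Matrix.of fun i j => w (Sum.inl (Sum.inr (i, j)))
  let B12 : Matrix C T R := Matrix.of fun i j => w (Sum.inr (Sum.inl (Sum.inl i, j)))
  let Bt : Matrix C A R := Matrix.of fun i j => w (Sum.inr (Sum.inr (Sum.inl (i, j))))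
  A11.det * ((A11.det • Bt + B12 * A21 * A11.adjugate).submatrix id hA).det

theorem map_freeDet {R R' : Type*} [CommRing R] [CommRing R'] (f : R →+* R') (hA : C → A)
    (w : FreeIndex A T U C V → R) : f (freeDet hA w) = freeDet hA (f ∘ w) := by
  simp only [freeDet, map_mul, RingHom.map_det, RingHom.mapMatrix_apply]
  congr 2
  have hadj := f.map_adjugate (Matrix.of fun i j => w (Sum.inl (Sum.inl (i, Sum.inl j))))
  rw [RingHom.mapMatrix_apply, RingHom.mapMatrix_apply] at hadj
  have hsmul : ∀ (d : R) (N : Matrix C A R), (d • N).map f = f d • N.map f := fun d N =>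
    Matrix.ext fun i j => map_mul f d (N i j)
  rw [← Matrix.submatrix_map, Matrix.map_add _ (map_add f), Matrix.map_mul, Matrix.map_mul, hadj,
    hsmul, RingHom.map_det]
  rfl

theorem freeDet_X_ne_zero {k : Type*} [Field k] {hA : C → A} (h : Function.Injective hA) :
    freeDet hA (MvPolynomial.X : FreeIndex A T U C V → MvPolynomial _ k) ≠ 0 := by
  intro h0
  let w : FreeIndex A T U C V → k :=
    Sum.elim (Sum.elim (fun p => Sum.elim (fun j => (1 : Matrix A A k) p.1 j) 0 p.2) 0)
      (Sum.elim 0 (Sum.elim (fun p => (1 : Matrix A A k) (hA p.1) p.2) 0))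
  have h1 := congrArg (MvPolynomial.aeval (R := k) w).toRingHom h0
  rw [map_freeDet, map_zero] at h1
  have hw : (MvPolynomial.aeval (R := k) w).toRingHom ∘ MvPolynomial.X = w := by
    funext i
    exact MvPolynomial.aeval_X _ _
  rw [hw] at h1
  have e1 : (Matrix.of fun i j => w (Sum.inl (Sum.inl (i, Sum.inl j)))) = (1 : Matrix A A k) := rfl
  have e2 : (Matrix.of fun i j => w (Sum.inl (Sum.inr (i, j)))) = (0 : Matrix T A k) := rfl
  have e3 : (Matrix.of fun i j => w (Sum.inr (Sum.inr (Sum.inl (i, j))))).submatrix id hA =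
      (1 : Matrix C C k) := by
    ext i j
    simp [w, Matrix.one_apply, h.eq_iff]
  simp only [freeDet, e1, e2, Matrix.mul_zero, Matrix.zero_mul, add_zero, Matrix.det_one,
    one_smul, e3, one_mul] at h1
  exact one_ne_zero h1

theorem det_ne_zero_of_freeDet_ne_zero {L : Type*} [Field L] {hA : C → A}
    {w : FreeIndex A T U C V → L} (hw : freeDet hA w ≠ 0) {A11 : Matrix A A L}
    {A21 : Matrix T A L} {B12 : Matrix C T L} {Bt : Matrix C A L}
    (h11 : ∀ i j, A11 i j = w (Sum.inl (Sum.inl (i, Sum.inl j))))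
    (h21 : ∀ i j, A21 i j = w (Sum.inl (Sum.inr (i, j))))
    (h12 : ∀ i j, B12 i j = w (Sum.inr (Sum.inl (Sum.inl i, j))))
    (ht : ∀ i j, Bt i j = w (Sum.inr (Sum.inr (Sum.inl (i, j))))) :
    A11.det ≠ 0 ∧ ((Bt + B12 * A21 * A11⁻¹).submatrix id hA).det ≠ 0 := by
  obtain rfl : A11 = Matrix.of fun i j => w (Sum.inl (Sum.inl (i, Sum.inl j))) :=
    Matrix.ext h11
  obtain rfl : A21 = Matrix.of fun i j => w (Sum.inl (Sum.inr (i, j))) := Matrix.ext h21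
  obtain rfl : B12 = Matrix.of fun i j => w (Sum.inr (Sum.inl (Sum.inl i, j))) := Matrix.ext h12
  obtain rfl : Bt = Matrix.of fun i j => w (Sum.inr (Sum.inr (Sum.inl (i, j)))) := Matrix.ext ht
  obtain ⟨hd, hd'⟩ := mul_ne_zero_iff.mp hw
  refine ⟨hd, fun h0 => hd' ?_⟩
  set A11 : Matrix A A L := Matrix.of fun i j => w (Sum.inl (Sum.inl (i, Sum.inl j)))
  have hadj : A11.adjugate = A11.det • A11⁻¹ := by
    rw [Matrix.inv_def, smul_smul, Ring.mul_inverse_cancel _ hd.isUnit, one_smul]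
  rw [hadj, Matrix.mul_smul, ← smul_add, Matrix.submatrix_smul]
  exact (Matrix.det_smul _ _).trans (by rw [h0, mul_zero])

variable [Fintype U] [Fintype V] [DecidableEq T]

theorem existsUnique_genericRankIdeal_point {k L : Type*} [Field k] [Field L] [Algebra k L]
    {r m n : ℕ} (er : A ⊕ T ≃ Fin r) (em : A ⊕ U ≃ Fin m) (en : C ⊕ V ≃ Fin n)
    (hA : C → A) (w : FreeIndex A T U C V → L) (hw : freeDet hA w ≠ 0) :
    ∃! z : (Fin r × Fin m) ⊕ (Fin n × Fin r) → L, z ∘ freeCoord er em en hA = w ∧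
      genericRankIdeal k r m n (Fintype.card A + 1) (Fintype.card C + Fintype.card T + 1)
        (Fintype.card C + 1) ≤ RingHom.ker (MvPolynomial.aeval (R := k) z) := by
  have hker : ∀ z : (Fin r × Fin m) ⊕ (Fin n × Fin r) → L,
      genericRankIdeal k r m n (Fintype.card A + 1) (Fintype.card C + Fintype.card T + 1)
        (Fintype.card C + 1) ≤ RingHom.ker (MvPolynomial.aeval (R := k) z) ↔
      (Matrix.of fun i j => z (Sum.inl (i, j))).rank ≤ Fintype.card A ∧
      (Matrix.of fun i j => z (Sum.inr (i, j))).rank ≤ Fintype.card C + Fintype.card T ∧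
      ((Matrix.of fun i j => z (Sum.inr (i, j))) *
        (Matrix.of fun i j => z (Sum.inl (i, j)))).rank ≤ Fintype.card C := by
    intro z
    obtain ⟨α, β, rfl⟩ : ∃ (α : Matrix (Fin r) (Fin m) L) (β : Matrix (Fin n) (Fin r) L),
        z = matrixPairCoord α β :=
      ⟨fun i j => z (Sum.inl (i, j)), fun i j => z (Sum.inr (i, j)), by
        funext p
        rcases p with p | p <;> rfl⟩
    have := genericRankIdeal_le_ker_iff (p := Fintype.card A + 1)
      (q := Fintype.card C + Fintype.card T + 1) (u := Fintype.card C + 1)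
      (MvPolynomial.aeval (R := k) (matrixPairCoord α β)).toRingHom
    simp only [AlgHom.toRingHom_eq_coe, RingHom.coe_coe,
      genericAlpha_map_aeval, genericBeta_map_aeval, Nat.lt_succ_iff] at this
    exact this
  have hrank : ∀ z : (Fin r × Fin m) ⊕ (Fin n × Fin r) → L,
      (Matrix.of fun i j => z (Sum.inl (i, j))).rank ≤ Fintype.card A ∧
      (Matrix.of fun i j => z (Sum.inr (i, j))).rank ≤ Fintype.card C + Fintype.card T ∧
      ((Matrix.of fun i j => z (Sum.inr (i, j))) *
        (Matrix.of fun i j => z (Sum.inl (i, j)))).rank ≤ Fintype.card C →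
      (Matrix.of fun i j => z (Sum.inl (er i, em j))).rank ≤ Fintype.card A ∧
      ((Matrix.of fun i j => z (Sum.inr (en i, er j))) *
        (Matrix.of fun i j => z (Sum.inl (er i, em j)))).rank ≤ Fintype.card C := by
    rintro z ⟨h1, -, h3⟩
    refine ⟨(Matrix.rank_submatrix_le (Matrix.of fun i j => z (Sum.inl (i, j))) er em).trans h1,
      le_trans (le_of_eq_of_le ?_ (Matrix.rank_submatrix_le _ en em)) h3⟩
    rw [← Matrix.submatrix_mul_equiv _ _ en er em]
    rfl
  simp only [hker]
  apply existsUnique_of_exists_of_unique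
  · obtain ⟨h1, h2⟩ := det_ne_zero_of_freeDet_ne_zero hw (fun _ _ => rfl) (fun _ _ => rfl)
      (fun _ _ => rfl) (fun _ _ => rfl)
    obtain ⟨α, β, ⟨hα, hβ, hβα⟩, e1, e2, e3, e4, e5⟩ := Matrix.exists_pair_of_blocks
      (Sum.inl : A → A ⊕ U) hA
      (Matrix.of fun i j => w (Sum.inl (Sum.inl (i, j))))
      (Matrix.of fun i j => w (Sum.inl (Sum.inr (i, j))))
      (Matrix.of fun i j => w (Sum.inr (Sum.inl (i, j))))
      (Matrix.of fun i j => w (Sum.inr (Sum.inr (Sum.inl (i, j)))))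
      (Matrix.of fun i j => w (Sum.inr (Sum.inr (Sum.inr (i, j))))) h1 h2
    refine ⟨matrixPairCoord (α.submatrix er.symm em.symm) (β.submatrix en.symm er.symm), ?_,
      (Matrix.rank_submatrix_le _ _ _).trans hα, (Matrix.rank_submatrix_le _ _ _).trans hβ, ?_⟩
    · funext p
      rcases p with ((⟨i, j⟩ | ⟨i, j⟩) | (⟨i, j⟩ | (⟨i, j⟩ | ⟨i, j⟩)))
      · simpa [freeCoord, matrixPairCoord] using congrFun (congrFun e1 i) j
      · simpa [freeCoord, matrixPairCoord] using congrFun (congrFun e2 i) j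
      · simpa [freeCoord, matrixPairCoord] using congrFun (congrFun e3 i) j
      · simpa [freeCoord, matrixPairCoord] using congrFun (congrFun e4 i) j
      · simpa [freeCoord, matrixPairCoord] using congrFun (congrFun e5 i) j
    · refine le_trans (le_of_eq_of_le ?_ (Matrix.rank_submatrix_le _ en.symm em.symm)) hβα
      rw [← Matrix.submatrix_mul_equiv _ _ en.symm er.symm em.symm]
      rfl
  · rintro z z' ⟨hz, hzr⟩ ⟨hz', hzr'⟩
    obtain ⟨hα, hβα⟩ := hrank z hzr
    obtain ⟨hα', hβα'⟩ := hrank z' hzr'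
    have hzw := congrFun hz
    have hzz : ∀ p, z (freeCoord er em en hA p) = z' (freeCoord er em en hA p) :=
      congrFun (hz.trans hz'.symm)
    obtain ⟨h1, h2⟩ := det_ne_zero_of_freeDet_ne_zero hw
      (fun i j => hzw (Sum.inl (Sum.inl (i, Sum.inl j)))) (fun i j => hzw (Sum.inl (Sum.inr (i, j))))
      (fun i j => hzw (Sum.inr (Sum.inl (Sum.inl i, j))))
      (fun i j => hzw (Sum.inr (Sum.inr (Sum.inl (i, j)))))
    obtain ⟨eα, eβ⟩ := Matrix.pair_ext_of_blocks Sum.inl hA hα hβα hα' hβα' h1 h2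
      (Matrix.ext fun i j => hzz (Sum.inl (Sum.inl (i, j))))
      (Matrix.ext fun i j => hzz (Sum.inl (Sum.inr (i, j))))
      (Matrix.ext fun i j => hzz (Sum.inr (Sum.inl (i, j))))
      (Matrix.ext fun i j => hzz (Sum.inr (Sum.inr (Sum.inl (i, j)))))
      (Matrix.ext fun i j => hzz (Sum.inr (Sum.inr (Sum.inr (i, j)))))
    funext p
    rcases p with ⟨i, j⟩ | ⟨i, j⟩
    · simpa using congrFun (congrFun eα (er.symm i)) (em.symm j)
    · simpa using congrFun (congrFun eβ (en.symm i)) (er.symm j)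

end FreeCoordinates

theorem ringKrullDim_quotient_radical_genericRankIdeal {k : Type*} [Field k] {r m n c s t u v : ℕ}
    (er : (Fin c ⊕ Fin s) ⊕ Fin t ≃ Fin r) (em : (Fin c ⊕ Fin s) ⊕ Fin u ≃ Fin m)
    (en : Fin c ⊕ Fin v ≃ Fin n)
    (hP : (genericRankIdeal k r m n (c + s + 1) (c + t + 1) (c + 1)).radical.IsPrime) :
    ringKrullDim (MvPolynomial ((Fin r × Fin m) ⊕ (Fin n × Fin r)) k ⧸
        (genericRankIdeal k r m n (c + s + 1) (c + t + 1) (c + 1)).radical) =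
      ((c + s) * (c + s + u) + t * (c + s) + ((c + v) * t + (c * (c + s) + v * c)) : ℕ) := by
  rw [MvPolynomial.ringKrullDim_quotient_eq_card _ (freeCoord er em en Sum.inl)
    (freeDet Sum.inl MvPolynomial.X) (freeDet_X_ne_zero Sum.inl_injective)]
  · simp
  · intro L _ _ w hw
    have hw' : freeDet Sum.inl w ≠ 0 := by
      have h := map_freeDet (MvPolynomial.aeval (R := k) w).toRingHom Sum.inl MvPolynomial.X
      have hX : (MvPolynomial.aeval (R := k) w).toRingHom ∘ MvPolynomial.X = w :=
        funext fun i => MvPolynomial.aeval_X _ _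
      rw [hX] at h
      rwa [← h]
    have := existsUnique_genericRankIdeal_point (k := k) er em en Sum.inl w hw'
    simpa [(RingHom.ker_isPrime (MvPolynomial.aeval (R := k) _)).isRadical.radical_le_iff] using this

/-- **From the proof of Example 4.1.**  Let `k` be an algebraically closed field,
`1 ≤ i ≤ r ≤ n ≤ m`, and `0 ≤ s ≤ r - i + 1`.  The locus `X_s` of pairs `(α, β)` with
`rank α ≤ s + i - 1`, `rank β ≤ r - s` and `rank (βα) ≤ i - 1` is an irreducible closed
subset of `Hom(k^m, k^r) × Hom(k^r, k^n)` of dimension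
`(s+i-1)(r+m-s-i+1) + (r-s)n + (i-1)s`: equivalently, the radical of
`I_{s+i}(α) + I_{r-s+1}(β) + I_i(βα)` for generic matrices `α`, `β` is prime, and the Krull
dimension of the quotient by it is `(s+i-1)(r+m-s-i+1) + (r-s)n + (i-1)s`. -/
theorem genericRankLocus_irreducible_dim {k : Type*} [Field k] [IsAlgClosed k]
    {i r m n s : ℕ} (h1 : 1 ≤ i) (h2 : i ≤ r) (h3 : r ≤ n) (h4 : n ≤ m)
    (hs : s ≤ r - i + 1) :
    (((genericAlpha k r m n).minorsIdeal (s + i) ⊔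
        (genericBeta k r m n).minorsIdeal (r - s + 1) ⊔
        (genericBeta k r m n * genericAlpha k r m n).minorsIdeal i).radical).IsPrime ∧
    ringKrullDim (MvPolynomial ((Fin r × Fin m) ⊕ (Fin n × Fin r)) k ⧸
        ((genericAlpha k r m n).minorsIdeal (s + i) ⊔
          (genericBeta k r m n).minorsIdeal (r - s + 1) ⊔
          (genericBeta k r m n * genericAlpha k r m n).minorsIdeal i).radical) =
      ((s + i - 1) * (r + m - s - i + 1) + (r - s) * n + (i - 1) * s : ℕ) := by
  obtain ⟨c, rfl⟩ : ∃ c, i = c + 1 := ⟨i - 1, by omega⟩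
  obtain ⟨t, rfl⟩ : ∃ t, r = c + s + t := ⟨r - (c + s), by omega⟩
  obtain ⟨u, rfl⟩ : ∃ u, m = c + s + u := ⟨m - (c + s), by omega⟩
  obtain ⟨v, rfl⟩ : ∃ v, n = c + v := ⟨n - c, by omega⟩
  have hsc : s + (c + 1) = c + s + 1 := by omega
  have hst : c + s + t - s = c + t := by omega
  have hdim : s + (c + 1) - 1 = c + s := by omega
  have hdim' : c + s + t + (c + s + u) - s - (c + 1) + 1 = c + s + t + u := by omega
  have er : ∀ a, (Fin c ⊕ Fin s) ⊕ Fin a ≃ Fin (c + s + a) := fun a =>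
    (Equiv.sumCongr finSumFinEquiv (Equiv.refl _)).trans finSumFinEquiv
  have hP := genericRankIdeal_radical_isPrime (m := c + s + u) (n := c + v) (k := k) (er t)
  have hd := ringKrullDim_quotient_radical_genericRankIdeal (er t) (er u)
    (finSumFinEquiv : Fin c ⊕ Fin v ≃ Fin (c + v)) hP
  rw [hdim, hdim', hst, hsc, Nat.add_sub_cancel]
  refine ⟨hP, hd.trans (congrArg _ ?_)⟩
  ring

end
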